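/- Let Γ be a simple graph, let S be a set of vertices of Γ, and let G be the induced subgraph of Γ on S. Then the group homomorphism RAAG(G) → RAAG(Γ) induced by sending each generator (vertex) of G to the corresponding generator of RAAG(Γ) is injective, and its image equals the subgroup of RAAG(Γ) generated by the images of the vertices belonging to S. -/

import Mathlib

/-- The commutator `[x, y] = x * y * x⁻¹ * y⁻¹`. -/
def gcomm {G : Type*} [Group G] (x y : G) : G := x * y * x⁻¹ * y⁻¹

/-- The RAAG relators of a simple graph: one commutator for each edge. -/
def RAAGrels {V : Type*} (Γ : SimpleGraph V) : Set (FreeGroup V) :=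
  {r | ∃ u v : V, Γ.Adj u v ∧ r = gcomm (FreeGroup.of u) (FreeGroup.of v)}

/-- The right-angled Artin group of a simple graph. -/
abbrev RAAG {V : Type*} (Γ : SimpleGraph V) : Type _ := PresentedGroup (RAAGrels Γ)

theorem gcomm_eq_one_iff {G : Type*} [Group G] {x y : G} : gcomm x y = 1 ↔ Commute x y := by
  rw [gcomm, mul_inv_eq_one, mul_inv_eq_iff_eq_mul, commute_iff_eq]

theorem map_gcomm {G H : Type*} [Group G] [Group H] (f : G →* H) (x y : G) :
    f (gcomm x y) = gcomm (f x) (f y) := by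
  simp [gcomm]

namespace RAAG

theorem commute_of {V : Type*} {Γ : SimpleGraph V} {u v : V} (h : Γ.Adj u v) :
    Commute (PresentedGroup.of (rels := RAAGrels Γ) u) (PresentedGroup.of v) := by
  rw [← gcomm_eq_one_iff]
  have hr : PresentedGroup.mk (RAAGrels Γ) (gcomm (FreeGroup.of u) (FreeGroup.of v)) = 1 :=
    PresentedGroup.one_of_mem ⟨u, v, h, rfl⟩
  rwa [map_gcomm] at hr

theorem lift_eq_one_of_mem_rels {V H : Type*} [Group H] {Γ : SimpleGraph V} {f : V → H}
    (hf : ∀ u v, Γ.Adj u v → Commute (f u) (f v)) : ∀ r ∈ RAAGrels Γ, FreeGroup.lift f r = 1 := by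
  rintro _ ⟨u, v, h, rfl⟩
  rw [map_gcomm, gcomm_eq_one_iff]
  simpa using hf u v h

/-- The homomorphism out of a right-angled Artin group determined by images of the vertices that
commute along edges. -/
def lift {V H : Type*} [Group H] {Γ : SimpleGraph V} (f : V → H)
    (hf : ∀ u v, Γ.Adj u v → Commute (f u) (f v)) : RAAG Γ →* H :=
  PresentedGroup.toGroup (lift_eq_one_of_mem_rels hf)

@[simp]
theorem lift_of {V H : Type*} [Group H] {Γ : SimpleGraph V} (f : V → H)
    (hf : ∀ u v, Γ.Adj u v → Commute (f u) (f v)) (v : V) :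
    lift f hf (PresentedGroup.of v) = f v :=
  PresentedGroup.toGroup.of _

/-- The homomorphism induced by the inclusion of an induced subgraph. -/
def induceHom {V : Type*} (Γ : SimpleGraph V) (S : Set V) : RAAG (Γ.induce S) →* RAAG Γ :=
  lift (fun v => PresentedGroup.of (v : V)) fun _ _ h => commute_of h

open Classical in
/-- The retraction killing the vertices outside `S`. -/
noncomputable def retraction {V : Type*} (Γ : SimpleGraph V) (S : Set V) :
    RAAG Γ →* RAAG (Γ.induce S) :=
  lift (fun v => if h : v ∈ S then PresentedGroup.of ⟨v, h⟩ else 1) fun u v h => by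
    by_cases hu : u ∈ S
    · by_cases hv : v ∈ S
      · simpa only [hu, hv, dite_true] using commute_of (Γ := Γ.induce S) (u := ⟨u, hu⟩)
          (v := ⟨v, hv⟩) h
      · simp [hv]
    · simp [hu]

theorem retraction_comp_induceHom {V : Type*} (Γ : SimpleGraph V) (S : Set V) :
    (retraction Γ S).comp (induceHom Γ S) = MonoidHom.id _ := by
  ext v
  simp [retraction, induceHom]

theorem range_induceHom {V : Type*} (Γ : SimpleGraph V) (S : Set V) :
    (induceHom Γ S).range =
      Subgroup.closure ((fun v : V => PresentedGroup.of (rels := RAAGrels Γ) v) '' S) := by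
  rw [MonoidHom.range_eq_map, ← PresentedGroup.closure_range_of, MonoidHom.map_closure,
    ← Set.range_comp, Set.image_eq_range]
  congr 2

end RAAG

/-- **Lemma (sub-RAAGs of induced subgraphs).**
If `G` is the induced subgraph of a simple graph `Γ` on a set `S` of vertices, then the
homomorphism `RAAG(G) → RAAG(Γ)` induced by sending each vertex of `G` to the corresponding
vertex of `Γ` is injective, and its image equals the subgroup of `RAAG(Γ)` generated by the
images of the vertices in `S`. -/
theorem raag_induced_subgraph (V : Type*) (Γ : SimpleGraph V) (S : Set V) :
    ∃ φ : RAAG (SimpleGraph.induce S Γ) →* RAAG Γ,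
      (∀ v : S, φ (PresentedGroup.of (rels := RAAGrels (SimpleGraph.induce S Γ)) v)
          = PresentedGroup.of (rels := RAAGrels Γ) (v : V)) ∧
      Function.Injective φ ∧
      MonoidHom.range φ
        = Subgroup.closure ((fun v : V => PresentedGroup.of (rels := RAAGrels Γ) v) '' S) := by
  exact ⟨RAAG.induceHom Γ S, fun v => by simp [RAAG.induceHom],
    Function.LeftInverse.injective
      (DFunLike.congr_fun (RAAG.retraction_comp_induceHom Γ S)), RAAG.range_induceHom Γ S⟩
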